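/- Let (E, b, T) be a Hilbert–Poincaré complex with associated operators B = b + b* and S as in the definition of the signature. If T is operator homotopic to -T through a norm-continuous path T_s of Poincaré duality operators on (E, b), then the path s ↦ (B + S)(B - S_s)^{-1} is a norm-continuous path of invertible operators connecting (B + S)(B - S)^{-1} to the identity, where S_s is the operator associated to T_s. -/

import Mathlib

/-!
Statement 1: If the duality operator `T` of a Hilbert–Poincaré complex `(E, b, T)` is
operator homotopic to `-T` through a norm-continuous path `T_s` of Poincaré duality
operators on `(E, b)`, then `s ↦ (B + S)(B - S_s)⁻¹` is a norm-continuous path of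
invertible operators connecting `(B + S)(B - S)⁻¹` to the identity.
-/

noncomputable section

open ContinuousLinearMap

structure HilbertPoincareComplex (n : ℕ) (H : Type*) [NormedAddCommGroup H]
    [InnerProductSpace ℂ H] [CompleteSpace H] where
  P : ℕ → H →L[ℂ] H
  b : H →L[ℂ] H
  T : H →L[ℂ] H
  P_selfAdjoint : ∀ p, IsSelfAdjoint (P p)
  P_idem : ∀ p, P p ∘L P p = P p
  P_orth : ∀ p q, p ≠ q → P p ∘L P q = 0
  P_bounded : ∀ p, n < p → P p = 0
  P_total : ∑ p ∈ Finset.range (n + 1), P p = ContinuousLinearMap.id ℂ H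
  b_deg : ∀ p, b ∘L P (p + 1) = P p ∘L (b ∘L P (p + 1))
  b_bot : b ∘L P 0 = 0
  b_sq : b ∘L b = 0
  T_deg : ∀ p, p ≤ n → T ∘L P p = P (n - p) ∘L (T ∘L P p)
  T_adjoint : ∀ p, p ≤ n →
    (ContinuousLinearMap.adjoint T) ∘L P p = ((-1 : ℂ) ^ ((n - p) * p)) • (T ∘L P p)
  T_b : ∀ p, p ≤ n →
    (T ∘L ContinuousLinearMap.adjoint b) ∘L P p + ((-1 : ℂ) ^ p) • ((b ∘L T) ∘L P p) = 0
  T_equiv : ∃ T' h₁ h₂ : H →L[ℂ] H,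
    T ∘L T' - ContinuousLinearMap.id ℂ H = b ∘L h₁ + h₁ ∘L b ∧
    T' ∘L T - ContinuousLinearMap.id ℂ H =
      (ContinuousLinearMap.adjoint b) ∘L h₂ + h₂ ∘L (ContinuousLinearMap.adjoint b)

/-- The operator `S` associated to a duality operator `T` on the graded complex with
grading projections `P`: `S v = i^(p(p-1)+l) T v` on degree-`p` vectors, `l = n / 2`. -/
def dualityOp (n : ℕ) {H : Type*} [NormedAddCommGroup H] [InnerProductSpace ℂ H]
    [CompleteSpace H] (P : ℕ → H →L[ℂ] H) (T : H →L[ℂ] H) : H →L[ℂ] H :=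
  ∑ p ∈ Finset.range (n + 1), (Complex.I ^ (p * (p - 1) + n / 2)) • (T ∘L P p)

section GradedOperators

variable {n : ℕ} {H : Type*} [NormedAddCommGroup H] [InnerProductSpace ℂ H] [CompleteSpace H]

/-- A self-adjoint operator that is bounded below is invertible. -/
theorem isUnit_of_isSelfAdjoint_of_bounded_below {D : H →L[ℂ] H} (hD : IsSelfAdjoint D)
    {C : ℝ} (hC : ∀ v, ‖v‖ ≤ C * ‖D v‖) : IsUnit D := by
  have hC' : ∀ v, ‖v‖ ≤ (|C| + 1) * ‖D v‖ := fun v =>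
    (hC v).trans (mul_le_mul_of_nonneg_right ((le_abs_self C).trans (by linarith))
      (norm_nonneg _))
  have hsq : IsUnit (D * D) := by
    refine ContinuousLinearMap.isUnit_of_forall_le_norm_inner_map (D * D)
      (c := NNReal.mk ((|C| + 1) ^ 2)⁻¹ (by positivity)) ?_ ?_
    · exact (by positivity : (0 : ℝ) < ((|C| + 1) ^ 2)⁻¹)
    · intro v
      have hinner : inner ℂ ((D * D) v) v = inner ℂ (D v) (D v) := by
        rw [mul_apply_eq_comp]
        exact hD.isSymmetric (D v) v
      rw [hinner, inner_self_eq_norm_sq_to_K, NNReal.coe_mk]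
      have hle : ‖v‖ ^ 2 ≤ (|C| + 1) ^ 2 * ‖D v‖ ^ 2 := by
        rw [← mul_pow]
        exact pow_le_pow_left₀ (norm_nonneg _) (hC' v) 2
      have hnorm : ‖((‖D v‖ : ℂ)) ^ 2‖ = ‖D v‖ ^ 2 := by simp
      refine le_trans ?_ hnorm.symm.le
      rw [mul_comm, inv_mul_le_iff₀ (by positivity)]
      exact hle
  exact ((Commute.refl D).isUnit_mul_iff.mp hsq).1

/-- If `S` is self-adjoint and anticommutes with the differential `b` in the sense
`b S = -S b*`, then `b + b* - S` is invertible as soon as the identity lies in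
`b* L + L (b - S) + L b*`, where `L` denotes the bounded operators. -/
theorem isUnit_add_star_sub_of_one_eq {b S K M N : H →L[ℂ] H} (hb : b * b = 0)
    (hS : IsSelfAdjoint S) (hbS : b * S = -(S * star b))
    (hone : 1 = star b * K + M * (b - S) + N * star b) : IsUnit (b + star b - S) := by
  have hbadj : ∀ x y, inner ℂ (star b x) y = inner ℂ x (b y) := fun x y => by
    rw [ContinuousLinearMap.star_eq_adjoint, ContinuousLinearMap.adjoint_inner_left]
  have hbadj' : ∀ x y, inner ℂ x (star b y) = inner ℂ (b x) y := fun x y => by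
    rw [ContinuousLinearMap.star_eq_adjoint, ContinuousLinearMap.adjoint_inner_right]
  have hSsymm : ∀ x y, inner ℂ (S x) y = inner ℂ x (S y) := fun x y => hS.isSymmetric x y
  have hskew : ∀ w, RCLike.re (inner ℂ (star b w) (S w)) = 0 := fun w => by
    have h : inner ℂ (star b w) (S w) = -inner ℂ (S w) (star b w) := by
      have := congrArg (fun X : H →L[ℂ] H => X w) hbS
      simp only [mul_apply_eq_comp, _root_.neg_apply] at this
      rw [hbadj, this, inner_neg_right, hSsymm]
    have h' := congrArg RCLike.re h
    rw [map_neg, inner_re_symm (S w) (star b w)] at h'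
    linarith
  have hD : IsSelfAdjoint (b + star b - S) := (IsSelfAdjoint.add_star_self b).sub hS
  refine isUnit_of_isSelfAdjoint_of_bounded_below hD
    (C := ‖K‖ + (‖M‖ + ‖N‖) * (‖S‖ * ‖K‖ + 1)) fun v => ?_
  have hpyth : ‖(b + star b - S) v‖ ^ 2 = ‖(b - S) v‖ ^ 2 + ‖star b v‖ ^ 2 := by
    have hsum : (b + star b - S) v = (b - S) v + star b v := by
      simp only [_root_.add_apply, _root_.sub_apply]
      abel
    have hcross : RCLike.re (inner ℂ ((b - S) v) (star b v)) = 0 := by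
      have hbb : b (b v) = 0 := congrArg (fun X : H →L[ℂ] H => X v) hb
      rw [_root_.sub_apply, inner_sub_left, map_sub, hbadj', hbb, inner_zero_left,
        inner_re_symm, hskew]
      simp
    rw [hsum, @norm_add_sq ℂ, hcross]
    ring
  have he₁ : ‖(b - S) v‖ ≤ ‖(b + star b - S) v‖ :=
    le_of_sq_le_sq (by nlinarith [sq_nonneg ‖star b v‖]) (norm_nonneg _)
  have he₂ : ‖star b v‖ ≤ ‖(b + star b - S) v‖ :=
    le_of_sq_le_sq (by nlinarith [sq_nonneg ‖(b - S) v‖]) (norm_nonneg _)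
  set d := ‖(b + star b - S) v‖
  obtain ⟨r, hr⟩ : ∃ r, r = M ((b - S) v) + N (star b v) := ⟨_, rfl⟩
  have hv : v = star b (K v) + r := by
    have := congrArg (fun X : H →L[ℂ] H => X v) hone
    simp only [one_apply_eq_self, _root_.add_apply,
      mul_apply_eq_comp] at this
    rw [hr, ← add_assoc]
    exact this
  have hrle : ‖r‖ ≤ (‖M‖ + ‖N‖) * d := by
    rw [hr, add_mul]
    exact (norm_add_le _ _).trans (add_le_add (M.le_opNorm_of_le he₁) (N.le_opNorm_of_le he₂))
  have hsq : ‖v‖ ^ 2 = RCLike.re (inner ℂ ((b - S) v) (K v)) +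
      RCLike.re (inner ℂ r (S (K v))) + RCLike.re (inner ℂ v r) := by
    have h₁ : inner ℂ v v = inner ℂ ((b - S) v) (K v) + inner ℂ v (S (K v)) + inner ℂ v r := by
      conv_lhs => rw [hv, inner_add_right, ← hv, hbadj']
      rw [_root_.sub_apply, inner_sub_left, hSsymm, sub_add_cancel]
    have h₂ : RCLike.re (inner ℂ v (S (K v))) = RCLike.re (inner ℂ r (S (K v))) := by
      have h := congrArg (fun x => RCLike.re (inner ℂ x (S (K v)))) hv
      simpa only [inner_add_left, map_add, hskew, zero_add] using h
    rw [← inner_self_eq_norm_sq (𝕜 := ℂ), h₁, map_add, map_add, h₂]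
  have hKv : ‖K v‖ ≤ ‖K‖ * ‖v‖ := K.le_opNorm v
  have hSKv : ‖S (K v)‖ ≤ ‖S‖ * (‖K‖ * ‖v‖) := S.le_opNorm_of_le hKv
  have hd : 0 ≤ d := norm_nonneg _
  have b₁ := (re_inner_le_norm (𝕜 := ℂ) ((b - S) v) (K v)).trans
    (mul_le_mul he₁ hKv (norm_nonneg _) hd)
  have b₂ := (re_inner_le_norm (𝕜 := ℂ) r (S (K v))).trans
    (mul_le_mul hrle hSKv (norm_nonneg _) (by positivity))
  have b₃ := (re_inner_le_norm (𝕜 := ℂ) v r).trans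
    (mul_le_mul_of_nonneg_left hrle (norm_nonneg _))
  rcases (norm_nonneg v).eq_or_lt with h0 | h0
  · rw [← h0]
    positivity
  · refine le_of_mul_le_mul_right ?_ h0
    nlinarith

namespace HilbertPoincareComplex

variable (Cx : HilbertPoincareComplex n H)

/-- The operator acting on the degree-`p` component as multiplication by `c p`. -/
def diag (c : ℕ → ℂ) : H →L[ℂ] H :=
  ∑ p ∈ Finset.range (n + 1), c p • Cx.P p

theorem diag_mul_P (c : ℕ → ℂ) (q : ℕ) : Cx.diag c * Cx.P q = c q • Cx.P q := by
  by_cases hq : n < q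
  · simp [Cx.P_bounded q hq]
  · rw [diag, Finset.sum_mul, Finset.sum_eq_single q]
    · rw [smul_mul_assoc]
      exact congrArg _ (Cx.P_idem q)
    · intro p _ hpq
      rw [smul_mul_assoc]
      exact (congrArg _ (Cx.P_orth p q hpq)).trans (smul_zero _)
    · intro h
      exact absurd (Finset.mem_range.mpr (by omega)) h

theorem ext_mul_P {X Y : H →L[ℂ] H} (h : ∀ q, q ≤ n → X * Cx.P q = Y * Cx.P q) : X = Y := by
  have htot : ∑ p ∈ Finset.range (n + 1), Cx.P p = 1 := Cx.P_total
  rw [← mul_one X, ← mul_one Y, ← htot, Finset.mul_sum, Finset.mul_sum]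
  exact Finset.sum_congr rfl fun q hq => h q (by simpa [Nat.lt_succ_iff] using hq)

theorem diag_mul_diag (c d : ℕ → ℂ) : Cx.diag c * Cx.diag d = Cx.diag fun p => c p * d p := by
  refine Cx.ext_mul_P fun q _ => ?_
  rw [mul_assoc, diag_mul_P, mul_smul_comm, diag_mul_P, diag_mul_P, smul_smul, mul_comm]

theorem diag_one : Cx.diag (fun _ => 1) = 1 := by
  refine Cx.ext_mul_P fun q _ => ?_
  rw [diag_mul_P, one_smul, one_mul]

theorem star_diag (c : ℕ → ℂ) : star (Cx.diag c) = Cx.diag fun p => star (c p) := by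
  simp only [diag, star_sum, star_smul]
  exact Finset.sum_congr rfl fun p _ => by rw [(Cx.P_selfAdjoint p).star_eq]

theorem b_mul_diag (c : ℕ → ℂ) : Cx.b * Cx.diag c = Cx.diag (fun p => c (p + 1)) * Cx.b := by
  refine Cx.ext_mul_P fun q _ => ?_
  rw [mul_assoc, mul_assoc, diag_mul_P, mul_smul_comm]
  cases q with
  | zero =>
    have h : Cx.b * Cx.P 0 = 0 := Cx.b_bot
    rw [h, smul_zero, mul_zero]
  | succ q =>
    have h : Cx.b * Cx.P (q + 1) = Cx.P q * (Cx.b * Cx.P (q + 1)) := Cx.b_deg q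
    rw [h, ← mul_assoc (Cx.diag _), diag_mul_P, smul_mul_assoc]

theorem diag_mul_star_b (c : ℕ → ℂ) :
    Cx.diag c * star Cx.b = star Cx.b * Cx.diag fun p => c (p + 1) := by
  have h := congrArg star (Cx.b_mul_diag fun p => star (c p))
  simpa only [star_mul, star_diag, star_star] using h

theorem T_mul_star_b :
    Cx.T * star Cx.b = -(Cx.b * Cx.T * Cx.diag fun p => (-1) ^ p) := by
  refine Cx.ext_mul_P fun q hq => ?_
  rw [neg_mul, mul_assoc (Cx.b * Cx.T), diag_mul_P, mul_smul_comm]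
  exact eq_neg_of_add_eq_zero_left (Cx.T_b q hq)

theorem b_mul_T : Cx.b * Cx.T = -(Cx.T * star Cx.b * Cx.diag fun p => (-1) ^ p) := by
  rw [T_mul_star_b, neg_mul, neg_neg, mul_assoc, diag_mul_diag]
  simp only [← mul_pow, neg_mul_neg, one_pow, diag_one, mul_one]

/-- The phase `i^(p(p-1)+l)` relating `S` to `T` in degree `p`. -/
def phase (n p : ℕ) : ℂ :=
  Complex.I ^ (p * (p - 1) + n / 2)

theorem dualityOp_eq_T_mul_diag : dualityOp n Cx.P Cx.T = Cx.T * Cx.diag (phase n) := by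
  rw [diag, Finset.mul_sum]
  exact Finset.sum_congr rfl fun p _ => (mul_smul_comm _ _ _).symm

theorem neg_one_pow_mul_phase_succ (n p : ℕ) : (-1) ^ p * phase n (p + 1) = phase n p := by
  have hexp : (p + 1) * (p + 1 - 1) = p * (p - 1) + 2 * p := by
    cases p with
    | zero => rfl
    | succ k => simp only [Nat.add_sub_cancel]; ring
  rw [phase, phase, hexp, ← Complex.I_sq, ← pow_mul, ← pow_add]
  have h4 : 2 * p + (p * (p - 1) + 2 * p + n / 2) = 4 * p + (p * (p - 1) + n / 2) := by ring
  rw [h4, pow_add, pow_mul, Complex.I_pow_four, one_pow, one_mul]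

theorem phase_ne_zero (n p : ℕ) : phase n p ≠ 0 :=
  pow_ne_zero _ Complex.I_ne_zero

theorem star_phase (n p : ℕ) : star (phase n p) = (phase n p)⁻¹ := by
  simp [phase, ← inv_pow]

theorem phase_mul_phase_sub {n q : ℕ} (hq : q ≤ n) :
    phase n q * phase n (n - q) = (-1) ^ ((n - q) * q) := by
  obtain ⟨m, rfl⟩ := Nat.exists_eq_add_of_le hq
  rw [Nat.add_sub_cancel_left, phase, phase, ← pow_add]
  have hpred : ∀ k : ℕ, k * (k - 1) + k = k * k := fun k => by
    cases k with
    | zero => rfl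
    | succ k => simp only [Nat.add_sub_cancel]; ring
  have h₁ := hpred q
  have h₂ := hpred m
  obtain ⟨t, ht⟩ : ∃ t, q * (q - 1) + (q + m) / 2 + (m * (m - 1) + (q + m) / 2) + 2 * (m * q) =
      4 * t := by
    rcases Nat.even_or_odd' (q + m) with ⟨k, hk | hk⟩
    · refine ⟨k * k, ?_⟩
      have : (q + m) / 2 = k := by omega
      rw [this]
      have : (q + m) * (q + m) = 4 * (k * k) := by rw [hk]; ring
      nlinarith
    · refine ⟨k * k + k, ?_⟩
      have : (q + m) / 2 = k := by omega
      rw [this]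
      have : (q + m) * (q + m) = 4 * (k * k + k) + 1 := by rw [hk]; ring
      nlinarith
  have hI := congrArg (Complex.I ^ ·) ht
  simp only [pow_add _ _ (2 * (m * q)), pow_mul Complex.I 4, Complex.I_pow_four, one_pow,
    pow_mul Complex.I 2 (m * q), Complex.I_sq] at hI
  rcases neg_one_pow_eq_or ℂ (m * q) with h | h
  · rw [h, mul_one] at hI
    rw [h, hI]
  · rw [h] at hI ⊢
    linear_combination -hI

theorem isSelfAdjoint_dualityOp : IsSelfAdjoint (dualityOp n Cx.P Cx.T) := by
  rw [dualityOp_eq_T_mul_diag, IsSelfAdjoint, star_mul, star_diag]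
  refine Cx.ext_mul_P fun q hq => ?_
  have hadj : star Cx.T * Cx.P q = (-1 : ℂ) ^ ((n - q) * q) • (Cx.T * Cx.P q) :=
    Cx.T_adjoint q hq
  have hdeg : Cx.T * Cx.P q = Cx.P (n - q) * (Cx.T * Cx.P q) := Cx.T_deg q hq
  have hdiag : ∀ c, Cx.diag c * (Cx.T * Cx.P q) = c (n - q) • (Cx.T * Cx.P q) := fun c => by
    rw [hdeg, ← mul_assoc, diag_mul_P, smul_mul_assoc]
  rw [mul_assoc, hadj, mul_smul_comm, hdiag, mul_assoc, diag_mul_P, mul_smul_comm, smul_smul,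
    ← phase_mul_phase_sub hq, star_phase, mul_inv_cancel_right₀ (phase_ne_zero _ _)]

theorem b_mul_dualityOp :
    Cx.b * dualityOp n Cx.P Cx.T = -(dualityOp n Cx.P Cx.T * star Cx.b) := by
  rw [dualityOp_eq_T_mul_diag, mul_assoc Cx.T, diag_mul_star_b, ← mul_assoc Cx.T, T_mul_star_b,
    neg_mul, neg_neg, mul_assoc (Cx.b * Cx.T), diag_mul_diag, mul_assoc]
  simp only [neg_one_pow_mul_phase_succ]

/-- The duality operator being a homotopy equivalence, the identity is a combination of `b*`
on the left with `b - S` and `b*` on the right. -/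
theorem exists_one_eq : ∃ K M N : H →L[ℂ] H,
    1 = star Cx.b * K + M * (Cx.b - dualityOp n Cx.P Cx.T) + N * star Cx.b := by
  obtain ⟨T', h₁, h₂, e₁, e₂⟩ := Cx.T_equiv
  have hTT' : Cx.T * T' = 1 + (Cx.b * h₁ + h₁ * Cx.b) := sub_eq_iff_eq_add'.mp e₁
  have hT'T : T' * Cx.T = 1 + (star Cx.b * h₂ + h₂ * star Cx.b) := sub_eq_iff_eq_add'.mp e₂
  have hbb : Cx.b * Cx.b = 0 := Cx.b_sq
  have hbb' : star Cx.b * star Cx.b = 0 := by rw [← star_mul, hbb, star_zero]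
  have hcomm₁ : Cx.T * T' * Cx.b = Cx.b * (Cx.T * T') := by
    rw [hTT', add_mul, mul_add, add_mul, mul_add, mul_assoc h₁, hbb, ← mul_assoc Cx.b Cx.b, hbb,
      mul_assoc Cx.b h₁]
    simp
  have hcomm₂ : T' * Cx.T * star Cx.b = star Cx.b * (T' * Cx.T) := by
    rw [hT'T, add_mul, mul_add, add_mul, mul_add, mul_assoc h₂, hbb',
      ← mul_assoc (star Cx.b) (star Cx.b), hbb', mul_assoc (star Cx.b) h₂]
    simp
  have hchain : T' * (Cx.T * T' * Cx.b) =
      star Cx.b * -(T' * Cx.T * (Cx.diag (fun p => (-1) ^ p) * T')) := by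
    calc T' * (Cx.T * T' * Cx.b) = T' * (Cx.b * Cx.T) * T' := by
          rw [hcomm₁]; simp only [mul_assoc]
      _ = -(T' * Cx.T * star Cx.b * (Cx.diag (fun p => (-1) ^ p) * T')) := by
          rw [b_mul_T]; noncomm_ring
      _ = _ := by rw [hcomm₂]; noncomm_ring
  have hsquare : T' * Cx.T * (T' * Cx.T) =
      1 + star Cx.b * (h₂ + h₂ * (T' * Cx.T)) + (h₂ + h₂ * (T' * Cx.T)) * star Cx.b := by
    have hcomm₃ : h₂ * (T' * Cx.T) * star Cx.b = h₂ * star Cx.b * (T' * Cx.T) := by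
      rw [mul_assoc, hcomm₂, mul_assoc]
    rw [add_mul h₂, hcomm₃]
    nth_rewrite 1 [hT'T]
    rw [add_mul, one_mul]
    nth_rewrite 1 [hT'T]
    noncomm_ring
  set U := Cx.diag (phase n) with hU
  set U' := Cx.diag (fun p => (phase n p)⁻¹) with hU'
  have hU'U : U' * U = 1 := by
    rw [hU, hU', diag_mul_diag]
    simp only [inv_mul_cancel₀ (phase_ne_zero _ _), diag_one]
  have hU'b : U' * star Cx.b = star Cx.b * Cx.diag fun p => (phase n (p + 1))⁻¹ :=
    Cx.diag_mul_star_b _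
  have hbU : star Cx.b * U = Cx.diag (fun p => phase n (p - 1)) * star Cx.b := by
    rw [diag_mul_star_b]
    rfl
  set V := Cx.diag fun p => (phase n (p + 1))⁻¹
  set W := Cx.diag fun p => phase n (p - 1)
  set h := h₂ + h₂ * (T' * Cx.T)
  set Q := -(T' * Cx.T * (Cx.diag (fun p => (-1) ^ p) * T'))
  refine ⟨V * (Q - h * U), -(U' * (T' * Cx.T * T')), -(U' * h * W), ?_⟩
  rw [dualityOp_eq_T_mul_diag, ← hU]
  calc (1 : H →L[ℂ] H) = U' * (1 * U) := by rw [one_mul, hU'U]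
    _ = U' * ((T' * Cx.T * (T' * Cx.T) - star Cx.b * h - h * star Cx.b) * U) := by
        rw [hsquare]; noncomm_ring
    _ = U' * (T' * (Cx.T * T' * Cx.b)) - U' * (T' * Cx.T * T') * (Cx.b - Cx.T * U) -
          U' * star Cx.b * h * U - U' * h * (star Cx.b * U) := by noncomm_ring
    _ = U' * star Cx.b * Q - U' * (T' * Cx.T * T') * (Cx.b - Cx.T * U) -
          U' * star Cx.b * h * U - U' * h * (star Cx.b * U) := by rw [hchain, ← mul_assoc U' _ Q]
    _ = _ := by rw [hU'b, hbU]; noncomm_ring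

theorem isUnit_sub_dualityOp : IsUnit (Cx.b + star Cx.b - dualityOp n Cx.P Cx.T) := by
  obtain ⟨K, M, N, h⟩ := Cx.exists_one_eq
  exact isUnit_add_star_sub_of_one_eq Cx.b_sq Cx.isSelfAdjoint_dualityOp Cx.b_mul_dualityOp h

end HilbertPoincareComplex

theorem dualityOp_neg (P : ℕ → H →L[ℂ] H) (T : H →L[ℂ] H) :
    dualityOp n P (-T) = -dualityOp n P T := by
  simp [dualityOp, ContinuousLinearMap.neg_comp, Finset.sum_neg_distrib]

theorem continuous_dualityOp (P : ℕ → H →L[ℂ] H) : Continuous (dualityOp n P) := by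
  unfold dualityOp
  exact continuous_finsetSum _ fun p _ =>
    (continuous_id.clm_comp continuous_const).fun_const_smul _

end GradedOperators

/-- If `T` is operator homotopic to `-T` through a path `T_s` of
analytically controlled Poincaré duality operators on `(E, b)`, then
`s ↦ (B + S)(B - S_s)⁻¹` is a norm-continuous path of invertibles connecting
`(B + S)(B - S)⁻¹` to the identity. -/
theorem statement1 {n : ℕ} {H : Type*} [NormedAddCommGroup H] [InnerProductSpace ℂ H]
    [CompleteSpace H] (Cx : HilbertPoincareComplex n H)
    (Ts : ℝ → (H →L[ℂ] H))
    (hcont : ContinuousOn Ts (Set.Icc 0 1))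
    (hT0 : Ts 0 = Cx.T) (hT1 : Ts 1 = -Cx.T)
    (hPC : ∀ s ∈ Set.Icc (0 : ℝ) 1, ∃ Cx' : HilbertPoincareComplex n H,
      Cx'.P = Cx.P ∧ Cx'.b = Cx.b ∧ Cx'.T = Ts s)
    (B S : H →L[ℂ] H)
    (hB : B = Cx.b + ContinuousLinearMap.adjoint Cx.b)
    (hS : S = dualityOp n Cx.P Cx.T) :
    (∀ s ∈ Set.Icc (0 : ℝ) 1, IsUnit (B - dualityOp n Cx.P (Ts s))) ∧
    ContinuousOn (fun s => (B + S) * Ring.inverse (B - dualityOp n Cx.P (Ts s)))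
      (Set.Icc (0 : ℝ) 1) ∧
    (B + S) * Ring.inverse (B - dualityOp n Cx.P (Ts 0)) =
      (B + S) * Ring.inverse (B - S) ∧
    (B + S) * Ring.inverse (B - dualityOp n Cx.P (Ts 1)) = 1 := by
  have hunit : ∀ s ∈ Set.Icc (0 : ℝ) 1, IsUnit (B - dualityOp n Cx.P (Ts s)) := by
    intro s hs
    obtain ⟨Cx', hP, hb, hT⟩ := hPC s hs
    rw [hB, ← hP, ← hb, ← hT]
    exact Cx'.isUnit_sub_dualityOp
  refine ⟨hunit, ?_, by rw [hT0, hS], ?_⟩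
  · intro s hs
    obtain ⟨u, hu⟩ := hunit s hs
    have hinv : ContinuousAt Ring.inverse (B - dualityOp n Cx.P (Ts s)) :=
      hu ▸ NormedRing.inverse_continuousAt u
    have hpath : ContinuousWithinAt (fun s => B - dualityOp n Cx.P (Ts s))
        (Set.Icc (0 : ℝ) 1) s :=
      continuousWithinAt_const.sub
        ((continuous_dualityOp Cx.P).continuousAt.comp_continuousWithinAt (hcont s hs))
    exact continuousWithinAt_const.mul
      (hinv.comp_continuousWithinAt (f := fun s => B - dualityOp n Cx.P (Ts s)) hpath)
  · have h1 := hunit 1 (by simp)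
    have heq : B - dualityOp n Cx.P (Ts 1) = B + S := by
      rw [hT1, dualityOp_neg, hS, sub_neg_eq_add]
    rw [heq] at h1 ⊢
    exact Ring.mul_inverse_cancel _ h1
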